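/- Let u ∈ ℝ² with u ≠ 0, d > 0, and z ≥ 1. The constrained minimization min over w ∈ ℝ² with ‖w − u‖ = d and t ≥ 0 of ‖z·ū − t·w̄‖² has optimal value b(z;u,d)², and the minimum is attained at w = v = (1 + d/‖u‖)·u together with t = z·⟨ū,v̄⟩/⟨v̄,v̄⟩. Equivalently, the Euclidean distance from z·ū to the lateral conical surface { t·w̄ : t ≥ 0, ‖w − u‖ = d } equals b(z;u,d). -/

import Mathlib

open RealInnerProductSpace

/-- Homogeneous lift of a 2D point `u` to `ū = (u₁, u₂, 1) ∈ ℝ³`. -/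
noncomputable def homLift (u : EuclideanSpace ℝ (Fin 2)) : EuclideanSpace ℝ (Fin 3) :=
  (WithLp.equiv 2 (Fin 3 → ℝ)).symm ![u 0, u 1, 1]

/-- The SDF lower bound `b(z; u, d) = z‖ū − (⟨v̄,ū⟩/⟨v̄,v̄⟩)v̄‖` with `v = (1 + d/‖u‖)u`. -/
noncomputable def lowerBound (z : ℝ) (u : EuclideanSpace ℝ (Fin 2)) (d : ℝ) : ℝ :=
  z * ‖homLift u - ((⟪homLift ((1 + d / ‖u‖) • u), homLift u⟫ : ℝ) /
        (⟪homLift ((1 + d / ‖u‖) • u), homLift ((1 + d / ‖u‖) • u)⟫ : ℝ)) •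
        homLift ((1 + d / ‖u‖) • u)‖

theorem inner_homLift (u w : EuclideanSpace ℝ (Fin 2)) :
    ⟪homLift u, homLift w⟫ = ⟪u, w⟫ + 1 := by
  simp [homLift, PiLp.inner_apply, Fin.sum_univ_succ]
  ring

theorem norm_smul_homLift_sub_sq (u w : EuclideanSpace ℝ (Fin 2)) (z t : ℝ) :
    ‖z • homLift u - t • homLift w‖ ^ 2 = ‖z • u - t • w‖ ^ 2 + (z - t) ^ 2 := by
  simp [homLift, EuclideanSpace.norm_sq_eq, Fin.sum_univ_succ]
  ring

/-- The distance from `z • ū` to the line spanned by `w̄` is at least `z‖w - u‖ / ‖w̄‖`. -/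
theorem sq_mul_norm_sub_sq_le (u w : EuclideanSpace ℝ (Fin 2)) {z : ℝ} (hz : 0 ≤ z) (t : ℝ) :
    z ^ 2 * ‖w - u‖ ^ 2 ≤ ‖z • homLift u - t • homLift w‖ ^ 2 * (1 + ‖w‖ ^ 2) := by
  rw [norm_smul_homLift_sub_sq]
  have h : z * ‖w - u‖ ≤ |z - t| * ‖w‖ + ‖z • u - t • w‖ := by
    calc z * ‖w - u‖ = ‖z • (w - u)‖ := by rw [norm_smul, Real.norm_of_nonneg hz]
      _ = ‖(z - t) • w - (z • u - t • w)‖ := by congr 1; module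
      _ ≤ ‖(z - t) • w‖ + ‖z • u - t • w‖ := norm_sub_le _ _
      _ = _ := by rw [norm_smul, Real.norm_eq_abs]
  calc z ^ 2 * ‖w - u‖ ^ 2 = (z * ‖w - u‖) ^ 2 := by ring
    _ ≤ (|z - t| * ‖w‖ + ‖z • u - t • w‖) ^ 2 := by gcongr
    _ ≤ (‖z • u - t • w‖ ^ 2 + |z - t| ^ 2) * (1 + ‖w‖ ^ 2) := by
      nlinarith [sq_nonneg (|z - t| - ‖z • u - t • w‖ * ‖w‖)]
    _ = _ := by rw [sq_abs]

theorem lowerBound_nonneg {z : ℝ} (hz : 0 ≤ z) (u : EuclideanSpace ℝ (Fin 2)) (d : ℝ) :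
    0 ≤ lowerBound z u d :=
  mul_nonneg hz (norm_nonneg _)

theorem lowerBound_sq {u : EuclideanSpace ℝ (Fin 2)} (hu : u ≠ 0) (z d : ℝ) :
    lowerBound z u d ^ 2 = z ^ 2 * d ^ 2 / (1 + (‖u‖ + d) ^ 2) := by
  have hr : ‖u‖ ≠ 0 := norm_ne_zero_iff.mpr hu
  obtain ⟨k, hk⟩ : ∃ k, k = 1 + d / ‖u‖ := ⟨_, rfl⟩
  have hd : d = (k - 1) * ‖u‖ := by rw [hk]; field_simp; ring
  have hsub (c : ℝ) : ‖homLift u - c • homLift (k • u)‖ ^ 2 =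
      (1 - c * k) ^ 2 * ‖u‖ ^ 2 + (1 - c) ^ 2 := by
    have h := norm_smul_homLift_sub_sq u (k • u) 1 c
    rw [one_smul, one_smul, smul_smul] at h
    rw [h, show u - (c * k) • u = (1 - c * k) • u by module, norm_smul, mul_pow,
      Real.norm_eq_abs, sq_abs]
  rw [lowerBound, ← hk, mul_pow, hsub, inner_homLift, inner_homLift]
  simp only [real_inner_smul_left, real_inner_self_eq_norm_sq, norm_smul, mul_pow,
    Real.norm_eq_abs, sq_abs]
  rw [hd]
  have h1 : k ^ 2 * ‖u‖ ^ 2 + 1 ≠ 0 := by positivity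
  have h2 : 1 + (‖u‖ + (k - 1) * ‖u‖) ^ 2 ≠ 0 := by positivity
  field_simp
  ring

theorem lowerBound_sq_le {u w : EuclideanSpace ℝ (Fin 2)} (hu : u ≠ 0) {z d : ℝ} (hz : 0 ≤ z)
    (hw : ‖w - u‖ = d) (t : ℝ) :
    lowerBound z u d ^ 2 ≤ ‖z • homLift u - t • homLift w‖ ^ 2 := by
  have hwn : ‖w‖ ≤ ‖u‖ + d := by
    rw [← hw]
    exact norm_le_norm_add_norm_sub' w u
  rw [lowerBound_sq hu, div_le_iff₀ (by positivity)]
  calc z ^ 2 * d ^ 2 ≤ ‖z • homLift u - t • homLift w‖ ^ 2 * (1 + ‖w‖ ^ 2) :=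
        hw ▸ sq_mul_norm_sub_sq_le u w hz t
    _ ≤ _ := by gcongr

/-- the minimization of `‖z • ū − t • w̄‖²` over `‖w − u‖ = d`, `t ≥ 0`
has optimal value `b(z;u,d)²`, attained at `w = v = (1 + d/‖u‖) • u` with
`t = z⟨ū,v̄⟩/⟨v̄,v̄⟩`; equivalently the distance from `z • ū` to the lateral conical
surface equals `b(z;u,d)`. -/
theorem min_dist_to_cone_surface
    (u : EuclideanSpace ℝ (Fin 2)) (hu : u ≠ 0) (d : ℝ) (hd : 0 < d)
    (z : ℝ) (hz : 1 ≤ z) :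
    (‖((1 + d / ‖u‖) • u : EuclideanSpace ℝ (Fin 2)) - u‖ = d ∧
      0 ≤ z * ((⟪homLift u, homLift ((1 + d / ‖u‖) • u)⟫ : ℝ) /
          (⟪homLift ((1 + d / ‖u‖) • u), homLift ((1 + d / ‖u‖) • u)⟫ : ℝ)) ∧
      ‖z • homLift u -
          (z * ((⟪homLift u, homLift ((1 + d / ‖u‖) • u)⟫ : ℝ) /
            (⟪homLift ((1 + d / ‖u‖) • u), homLift ((1 + d / ‖u‖) • u)⟫ : ℝ))) •
            homLift ((1 + d / ‖u‖) • u)‖ ^ 2 = (lowerBound z u d) ^ 2) ∧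
    (∀ (w : EuclideanSpace ℝ (Fin 2)) (t : ℝ), ‖w - u‖ = d → 0 ≤ t →
        (lowerBound z u d) ^ 2 ≤ ‖z • homLift u - t • homLift w‖ ^ 2) ∧
    Metric.infDist (z • homLift u)
        {x | ∃ t : ℝ, 0 ≤ t ∧ ∃ w : EuclideanSpace ℝ (Fin 2), ‖w - u‖ = d ∧ x = t • homLift w}
      = lowerBound z u d := by
  have hz0 : 0 ≤ z := zero_le_one.trans hz
  have hr : 0 < ‖u‖ := norm_pos_iff.mpr hu
  have hv : ‖((1 + d / ‖u‖) • u : EuclideanSpace ℝ (Fin 2)) - u‖ = d := by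
    rw [show (1 + d / ‖u‖) • u - u = (d / ‖u‖) • u by module, norm_smul,
      Real.norm_of_nonneg (by positivity), div_mul_cancel₀ _ hr.ne']
  have ht : 0 ≤ z * (⟪homLift u, homLift ((1 + d / ‖u‖) • u)⟫ /
      ⟪homLift ((1 + d / ‖u‖) • u), homLift ((1 + d / ‖u‖) • u)⟫) := by
    refine mul_nonneg hz0 (div_nonneg ?_ real_inner_self_nonneg)
    rw [inner_homLift, real_inner_smul_right, real_inner_self_eq_norm_sq]
    positivity
  have heq : ‖z • homLift u - (z * (⟪homLift u, homLift ((1 + d / ‖u‖) • u)⟫ /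
      ⟪homLift ((1 + d / ‖u‖) • u), homLift ((1 + d / ‖u‖) • u)⟫)) •
        homLift ((1 + d / ‖u‖) • u)‖ = lowerBound z u d := by
    rw [lowerBound, mul_smul, ← smul_sub, norm_smul, Real.norm_of_nonneg hz0,
      real_inner_comm (homLift u)]
  refine ⟨⟨hv, ht, by rw [heq]⟩, fun w t hw _ => lowerBound_sq_le hu hz0 hw t, le_antisymm ?_ ?_⟩
  · rw [← heq, ← dist_eq_norm]
    exact Metric.infDist_le_dist_of_mem ⟨_, ht, _, hv, rfl⟩
  · rw [Metric.le_infDist (by exact ⟨_, _, ht, _, hv, rfl⟩)]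
    rintro _ ⟨t, -, w, hw, rfl⟩
    rw [dist_eq_norm]
    exact (sq_le_sq₀ (lowerBound_nonneg hz0 u d) (norm_nonneg _)).mp
      (lowerBound_sq_le hu hz0 hw t)
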